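/- Let P be a finite B-semimodule. Then P is injective — meaning that for every injective SupBotHom f : M → N between finite B-semimodules and every SupBotHom g : M → P there exists a SupBotHom h : N → P with h ∘ f = g — if and only if P is a retract of a finite free B-semimodule, i.e. there exist n and SupBotHoms ι : P → (Fin n → Bool) and p : (Fin n → Bool) → P with p ∘ ι = id. Consequently, injective and projective objects among finite B-semimodules coincide. -/

import Mathlib

/-- The homomorphism from a finite free `B`-semimodule sending the `i`-th generator to `m i`. -/
def SupBotHom.freeLift {ι M : Type*} [Fintype ι] [SemilatticeSup M] [OrderBot M] (m : ι → M) :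
    SupBotHom (ι → Bool) M where
  toFun v := Finset.univ.sup fun i => bif v i then m i else ⊥
  map_sup' v w := by
    rw [← Finset.sup_sup]
    refine Finset.sup_congr rfl fun i _ => ?_
    cases hv : v i <;> cases hw : w i <;> simp [hv, hw]
  map_bot' := by simp

theorem SupBotHom.freeLift_apply {ι M : Type*} [Fintype ι] [SemilatticeSup M] [OrderBot M]
    (m : ι → M) (v : ι → Bool) :
    freeLift m v = Finset.univ.sup fun i => bif v i then m i else ⊥ :=
  rfl

theorem SupBotHom.freeLift_single {ι M : Type*} [Fintype ι] [DecidableEq ι] [SemilatticeSup M]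
    [OrderBot M] (m : ι → M) (i : ι) : freeLift m (fun j => decide (j = i)) = m i := by
  rw [freeLift_apply]
  apply le_antisymm
  · refine Finset.sup_le fun j _ => ?_
    by_cases h : j = i <;> simp [h]
  · refine le_trans ?_ (Finset.le_sup (Finset.mem_univ i))
    simp

theorem SupBotHom.map_freeLift {ι M N : Type*} [Fintype ι] [SemilatticeSup M] [OrderBot M]
    [SemilatticeSup N] [OrderBot N] (f : SupBotHom M N) (m : ι → M) (v : ι → Bool) :
    f (freeLift m v) = freeLift (fun i => f (m i)) v := by
  rw [freeLift_apply, freeLift_apply, map_finset_sup]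
  refine Finset.sup_congr rfl fun i _ => ?_
  cases h : v i <;> simp [h]

theorem SupBotHom.freeLift_generators {ι : Type*} [Fintype ι] [DecidableEq ι] (v : ι → Bool) :
    freeLift (fun i j => decide (j = i)) v = v := by
  rw [freeLift_apply]
  apply le_antisymm
  · refine Finset.sup_le fun i _ j => ?_
    by_cases h : j = i
    · subst h; cases hv : v j <;> simp
    · cases v i <;> simp [h]
  · intro j
    refine le_trans ?_ (Finset.le_sup (f := fun i => bif v i then fun j => decide (j = i) else ⊥)
      (Finset.mem_univ j) j)
    cases v j <;> simp

open Classical in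
/-- The embedding of a `B`-semimodule into a free one, recording in the coordinate `i` whether an
element fails to lie below `a i`. -/
noncomputable def SupBotHom.notLE {ι P : Type*} [SemilatticeSup P] [OrderBot P] (a : ι → P) :
    SupBotHom P (ι → Bool) where
  toFun x i := !decide (x ≤ a i)
  map_sup' x y := by
    ext i
    simp [Bool.decide_and]
  map_bot' := by
    ext i
    simp

theorem SupBotHom.notLE_injective {ι P : Type*} [SemilatticeSup P] [OrderBot P] {a : ι → P}
    (ha : Function.Surjective a) : Function.Injective (notLE a) := by
  intro x y h
  have key (i : ι) : x ≤ a i ↔ y ≤ a i := by simpa [notLE] using congrFun h i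
  refine eq_of_forall_ge_iff fun c => ?_
  obtain ⟨i, rfl⟩ := ha c
  exact key i

open Classical in
/-- Homomorphisms into a free `B`-semimodule extend along injective homomorphisms. -/
theorem SupBotHom.exists_extension_free {ι M N : Type*} [SemilatticeSup M] [OrderBot M]
    [SemilatticeSup N] [OrderBot N] (f : SupBotHom M N) (hf : Function.Injective f)
    (g : SupBotHom M (ι → Bool)) : ∃ h : SupBotHom N (ι → Bool), ∀ x, h (f x) = g x := by
  refine ⟨⟨⟨fun y i => !decide (∃ m, g m i = false ∧ y ≤ f m), fun y z => ?_⟩, ?_⟩, fun x => ?_⟩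
  · ext i
    have : (∃ m, g m i = false ∧ y ⊔ z ≤ f m) ↔
        (∃ m, g m i = false ∧ y ≤ f m) ∧ ∃ m, g m i = false ∧ z ≤ f m := by
      constructor
      · rintro ⟨m, hm, hle⟩
        exact ⟨⟨m, hm, le_sup_left.trans hle⟩, ⟨m, hm, le_sup_right.trans hle⟩⟩
      · rintro ⟨⟨m, hm, hy⟩, ⟨k, hk, hz⟩⟩
        exact ⟨m ⊔ k, by simp [hm, hk], by rw [map_sup]; exact sup_le_sup hy hz⟩
    simp only [this, Bool.decide_and, Bool.not_and, Pi.sup_apply, Bool.sup_eq_bor]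
  · ext i
    have : ∃ m, g m i = false ∧ ⊥ ≤ f m := ⟨⊥, by simp, bot_le⟩
    simp only [this, decide_true, Bool.not_true, Pi.bot_apply]
    rfl
  · ext i
    have : (∃ m, g m i = false ∧ f x ≤ f m) ↔ g x i = false := by
      constructor
      · rintro ⟨m, hm, hle⟩
        have hxm : x ≤ m := by
          rw [← sup_eq_right]
          exact hf (by rw [map_sup, sup_eq_right.mpr hle])
        have := OrderHomClass.mono g hxm i
        rw [hm] at this
        exact le_bot_iff.mp this
      · exact fun h => ⟨x, h, le_rfl⟩
    change (!decide (∃ m, g m i = false ∧ f x ≤ f m)) = g x i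
    simp only [this]
    cases g x i <;> rfl

/-- Homomorphisms out of a finite free `B`-semimodule lift along surjective homomorphisms. -/
theorem SupBotHom.exists_lift_free {ι M N : Type*} [Fintype ι] [SemilatticeSup M] [OrderBot M]
    [SemilatticeSup N] [OrderBot N] (f : SupBotHom M N) (hf : Function.Surjective f)
    (g : SupBotHom (ι → Bool) N) : ∃ h : SupBotHom (ι → Bool) M, ∀ v, f (h v) = g v := by
  classical
  choose m hm using fun i => hf (g fun j => decide (j = i))
  refine ⟨freeLift m, fun v => ?_⟩
  rw [map_freeLift]
  simp only [hm]
  rw [← map_freeLift, freeLift_generators]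

/-- A finite B-semimodule is injective (has the extension property against
injections of finite B-semimodules) iff it is a retract of a finite free
B-semimodule; consequently injective and projective finite B-semimodules coincide. -/
theorem stmt_8 {P : Type} [SemilatticeSup P] [OrderBot P] [Finite P] :
    ((∀ (M N : Type) [SemilatticeSup M] [OrderBot M] [Finite M]
        [SemilatticeSup N] [OrderBot N] [Finite N]
        (f : SupBotHom M N), Function.Injective f →
        ∀ g : SupBotHom M P, ∃ h : SupBotHom N P, ∀ x : M, h (f x) = g x) ↔
      (∃ (n : ℕ) (ι : SupBotHom P (Fin n → Bool)) (p : SupBotHom (Fin n → Bool) P),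
          ∀ x : P, p (ι x) = x)) ∧
    ((∀ (M N : Type) [SemilatticeSup M] [OrderBot M] [Finite M]
        [SemilatticeSup N] [OrderBot N] [Finite N]
        (f : SupBotHom M N), Function.Injective f →
        ∀ g : SupBotHom M P, ∃ h : SupBotHom N P, ∀ x : M, h (f x) = g x) ↔
      (∀ (M N : Type) [SemilatticeSup M] [OrderBot M] [Finite M]
          [SemilatticeSup N] [OrderBot N] [Finite N]
          (f : SupBotHom M N), Function.Surjective f →
          ∀ g : SupBotHom P N, ∃ h : SupBotHom P M, ∀ x : P, f (h x) = g x)) := by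
  obtain ⟨n, ⟨e⟩⟩ := Finite.exists_equiv_fin P
  have injective_of_retract (n : ℕ) (ι : SupBotHom P (Fin n → Bool))
      (p : SupBotHom (Fin n → Bool) P) (hp : ∀ x, p (ι x) = x)
      (M N : Type) [SemilatticeSup M] [OrderBot M] [Finite M]
      [SemilatticeSup N] [OrderBot N] [Finite N] (f : SupBotHom M N)
      (hf : Function.Injective f) (g : SupBotHom M P) :
      ∃ h : SupBotHom N P, ∀ x : M, h (f x) = g x := by
    obtain ⟨h, hh⟩ := f.exists_extension_free hf (ι.comp g)
    exact ⟨p.comp h, fun x => by simp [hh, hp]⟩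
  have retract_of_injective (H : ∀ (M N : Type) [SemilatticeSup M] [OrderBot M] [Finite M]
      [SemilatticeSup N] [OrderBot N] [Finite N] (f : SupBotHom M N), Function.Injective f →
      ∀ g : SupBotHom M P, ∃ h : SupBotHom N P, ∀ x : M, h (f x) = g x) :
      ∃ (n : ℕ) (ι : SupBotHom P (Fin n → Bool)) (p : SupBotHom (Fin n → Bool) P),
        ∀ x : P, p (ι x) = x := by
    obtain ⟨p, hp⟩ := H P (Fin n → Bool) (.notLE e.symm)
      (SupBotHom.notLE_injective e.symm.surjective) (.id P)
    exact ⟨n, _, p, hp⟩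
  refine ⟨⟨retract_of_injective, fun ⟨n, ι, p, hp⟩ => injective_of_retract n ι p hp⟩,
    fun H => ?_, fun H => ?_⟩
  · obtain ⟨k, ι, p, hp⟩ := retract_of_injective H
    intro M N _ _ _ _ _ _ f hf g
    obtain ⟨h, hh⟩ := f.exists_lift_free hf (g.comp p)
    exact ⟨h.comp ι, fun x => by simp [hh, hp]⟩
  · obtain ⟨ι, hι⟩ := H (Fin n → Bool) P (.freeLift e.symm)
      (fun x => ⟨_, (SupBotHom.freeLift_single _ (e x)).trans (e.symm_apply_apply x)⟩) (.id P)
    exact injective_of_retract n ι _ hι
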